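/- arXiv:2312.15772 — 2 statements merged into one kernel-verified Lean document; each statement's English description precedes it below -/
import Mathlib

section
/- Let d ≥ 2, 1 ≤ m ≤ d−1, λ ∈ (0,1/2), γ ∈ ℝ, and let 𝔇 = m log 2 / log(1/λ). Then there is a constant C = C(d,m,λ,γ) such that for all r ∈ (0,1), the m-dimensional Lebesgue measure of the r-neighborhood of the Cantor set satisfies ℒ^m({ x̄ ∈ ℝ^m : dist(x̄, 𝔠^m_{λ,γ}) ≤ r }) ≤ C · r^{m−𝔇} · (log(e + r^{−1}))^{γ𝔇}. -/
open MeasureTheory Real Set Metric Filter Topology NNReal ENNReal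

noncomputable section

/-- `ℝ^n` with the Euclidean structure. -/
abbrev Euc (n : ℕ) := EuclideanSpace ℝ (Fin n)

/-- The open cube `(-1,1)^n`. -/
def Box (n : ℕ) : Set (Euc n) := {x | ∀ i, |x i| < 1}

/-- The last coordinate `x_d` of `x ∈ ℝ^{n+1}`. -/
def lastC {n : ℕ} (x : Euc (n + 1)) : ℝ := x (Fin.last n)

/-- The first `n` coordinates `x̄` of `x ∈ ℝ^{n+1}`. -/
def frontC {n : ℕ} (x : Euc (n + 1)) : Euc n := WithLp.toLp 2 fun i => x i.castSucc

/-- Assemble a point of `ℝ^{n+1}` from `x̄ ∈ ℝ^n` and a last coordinate. -/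
def snocC {n : ℕ} (xb : Euc n) (t : ℝ) : Euc (n + 1) :=
  WithLp.toLp 2 (Fin.snoc (α := fun _ => ℝ) xb t)

/-- The first `m` coordinates of `x ∈ ℝ^{m+k}`. -/
def barPart {m k : ℕ} (x : Euc (m + k)) : Euc m := WithLp.toLp 2 fun i => x (Fin.castAdd k i)

/-- The last `k` coordinates of `x ∈ ℝ^{m+k}`. -/
def hatPart {m k : ℕ} (x : Euc (m + k)) : Euc k := WithLp.toLp 2 fun i => x (Fin.natAdd m i)

/-- Admissibility of a sequence of interval lengths for the generalized `(λ,γ)`-Cantor set: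
`l 0 = 1`, the lengths decrease fast enough (`l_{j-1} > 2 l_j`, removed gaps decreasing), and
`l j` is comparable to `λ^j j^γ`. -/
def IsCantorLengths (lam gam : ℝ) (l : ℕ → ℝ) : Prop :=
  l 0 = 1 ∧ (∀ j, 0 < l j) ∧ (∀ j, 2 * l (j + 1) < l j) ∧
    (∀ j, l (j + 1) - 2 * l (j + 2) < l j - 2 * l (j + 1)) ∧
    ∃ C : ℝ, 1 ≤ C ∧ ∀ j : ℕ, 1 ≤ j →
      C⁻¹ * lam ^ j * (j : ℝ) ^ gam ≤ l j ∧ l j ≤ C * lam ^ j * (j : ℝ) ^ gam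

/-- The point of the generalized Cantor set with address `ε` (left endpoints of the nested
intervals converge to this point). -/
def gCantorPoint (l : ℕ → ℝ) (ε : ℕ → Bool) : ℝ :=
  -(1 / 2 : ℝ) + ∑' j : ℕ, if ε j then l j - l (j + 1) else 0

/-- The generalized Cantor set determined by the lengths `l`. -/
def gCantorSet (l : ℕ → ℝ) : Set ℝ := Set.range (gCantorPoint l)

/-- The `m`-fold Cartesian power of the generalized Cantor set, inside `ℝ^m`. -/
def gCantorSetPi (l : ℕ → ℝ) (m : ℕ) : Set (Euc m) := {x | ∀ i, x i ∈ gCantorSet l}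

/-- The `j`-th binary digit of `t`. -/
def binDigit (t : ℝ) (j : ℕ) : Bool := ⌊t * 2 ^ (j + 1)⌋ % 2 = 1

/-- The Cantor measure attached to the lengths `l`: the image of the uniform distribution on
`[0,1)` under the map sending `t` to the Cantor point whose address is the binary digit
sequence of `t` (the digits being i.i.d. fair coins, this is the weak limit of the uniform
distributions on the pre-Cantor sets). -/
def gCantorMeasure (l : ℕ → ℝ) : Measure ℝ :=
  Measure.map (fun t => gCantorPoint l (binDigit t)) (volume.restrict (Set.Ico (0 : ℝ) 1))

/-- The `m`-fold product of the Cantor measure, as a measure on `ℝ^m`. -/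
def gCantorMeasurePi (l : ℕ → ℝ) (m : ℕ) : Measure (Euc m) :=
  Measure.map (⇑(MeasurableEquiv.toLp 2 (Fin m → ℝ)))
    (Measure.pi fun _ : Fin m => gCantorMeasure l)

/-- The fractal dimension `𝔇 = m log 2 / log(1/λ)`. -/
def frD (m : ℕ) (lam : ℝ) : ℝ := m * Real.log 2 / Real.log lam⁻¹

/-- `G` is the weak (distributional) differential of `u` on `Ω`:
integration by parts against smooth compactly supported test functions holds. -/
def HasWeakFDerivOn {n : ℕ} (Ω : Set (Euc n)) (u : Euc n → ℝ)
    (G : Euc n → Euc n →L[ℝ] ℝ) : Prop :=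
  ∀ φ : Euc n → ℝ, ContDiff ℝ (⊤ : ℕ∞) φ → HasCompactSupport φ → tsupport φ ⊆ Ω →
    ∫ x in Ω, u x • fderiv ℝ φ x = -∫ x in Ω, φ x • G x

/-- `u ∈ W^{1,1}(Ω)` with weak differential `G`. -/
def W11On {n : ℕ} (Ω : Set (Euc n)) (u : Euc n → ℝ) (G : Euc n → Euc n →L[ℝ] ℝ) : Prop :=
  IntegrableOn u Ω ∧ IntegrableOn G Ω ∧ HasWeakFDerivOn Ω u G

/-- `w ∈ W^{1,1}_0(Ω)` (with weak differential `G`): the extensions by zero form a Sobolev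
function on all of `ℝ^n`. -/
def ZeroBoundary {n : ℕ} (Ω : Set (Euc n)) (w : Euc n → ℝ)
    (G : Euc n → Euc n →L[ℝ] ℝ) : Prop :=
  Integrable (Set.indicator Ω w) ∧ Integrable (Set.indicator Ω G) ∧
    HasWeakFDerivOn Set.univ (Set.indicator Ω w) (Set.indicator Ω G)

/-- The energy `∫_Ω φ(x, g x) dx` for a scalar field `g` (typically `g = |∇w|`). -/
def energyOf {n : ℕ} (Ω : Set (Euc n)) (φ : Euc n → ℝ → ℝ) (g : Euc n → ℝ) : ℝ≥0∞ :=
  ∫⁻ x in Ω, ENNReal.ofReal (φ x (g x))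

/-- The Young (Legendre–Fenchel) conjugate `φ*(s) = sup_{t ≥ 0} (s t − φ(t))`. -/
def conjOrlicz (φ : ℝ → ℝ) (s : ℝ) : ℝ≥0∞ :=
  ⨆ t : ℝ≥0, ENNReal.ofReal (s * t - φ t)

/-- The conjugate energy `∫_Ω φ*(x, g x) dx`. -/
def energyConj {n : ℕ} (Ω : Set (Euc n)) (φ : Euc n → ℝ → ℝ) (g : Euc n → ℝ) : ℝ≥0∞ :=
  ∫⁻ x in Ω, conjOrlicz (φ x) (g x)

/-- `u` (with weak differential `G`, finite energy) is a local minimizer of the functional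
`w ↦ ∫_Ω φ(x,|∇w|) dx`: its energy does not exceed that of any Sobolev competitor that agrees
with `u` a.e. outside a compact subset of `Ω`. -/
def IsLocalMinimizer {n : ℕ} (Ω : Set (Euc n)) (φ : Euc n → ℝ → ℝ) (u : Euc n → ℝ)
    (G : Euc n → Euc n →L[ℝ] ℝ) : Prop :=
  W11On Ω u G ∧ energyOf Ω φ (fun x => ‖G x‖) < ⊤ ∧
    ∀ v Gv, W11On Ω v Gv →
      (∃ K : Set (Euc n), IsCompact K ∧ K ⊆ Ω ∧ ∀ᵐ x ∂(volume.restrict Ω), x ∉ K → v x = u x) →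
      energyOf Ω φ (fun x => ‖G x‖) ≤ energyOf Ω φ (fun x => ‖Gv x‖)

/-- `x` is a non-Lebesgue point of `u`: the averages of `|u − c|` on small balls around `x`
do not converge to `0` for any constant `c`. -/
def IsNonLebesguePoint {n : ℕ} (u : Euc n → ℝ) (x : Euc n) : Prop :=
  ¬ ∃ c : ℝ, Tendsto (fun r : ℝ => ⨍ y in Metric.ball x r, |u y - c| ∂volume)
      (𝓝[>] (0 : ℝ)) (𝓝 0)

/-- Membership in the Hölder class `C^α` on `s` (for `α ≥ 1` interpreted via
`C^{⌊α⌋, α − ⌊α⌋}`). -/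
def InHolderCls {n : ℕ} (α : ℝ) (s : Set (Euc n)) (a : Euc n → ℝ) : Prop :=
  ContDiffOn ℝ (⌊α⌋₊ : ℕ) a s ∧
    ∃ C : ℝ≥0, HolderOnWith C (Real.toNNReal (α - ⌊α⌋₊))
      (fun x => iteratedFDerivWithin ℝ ⌊α⌋₊ a s x) s

/-- The restricted Riesz potential `I₁^⋈(|f|)(x̄,0) = ∫_{C((x̄,0))} |f(y)| |x−y|^{1−d} dy`,
where `C(x)` is the double cone `{y : |ȳ − x̄| ≤ |y_d − x_d|/2}` (here `d = n+1`). -/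
def rieszBow {n : ℕ} (f : Euc (n + 1) → ℝ) (xb : Euc n) : ℝ≥0∞ :=
  ∫⁻ y : Euc (n + 1),
    ENNReal.ofReal ((if dist (frontC y) xb ≤ |lastC y| / 2 then (1 : ℝ) else 0) *
      |f y| * Real.sqrt (dist (frontC y) xb ^ 2 + lastC y ^ 2) ^ (-(n : ℝ)))

/-- The upper average `⟨f⟩⁺_{x̄,r} = ∫_{B_1} ω(y) f(x̄ + |r| ȳ, |r| y_d + |r|) dy`. -/
def avgPlus {n : ℕ} (ω : Euc (n + 1) → ℝ) (f : Euc (n + 1) → ℝ) (xb : Euc n) (r : ℝ) : ℝ :=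
  ∫ y in Metric.ball (0 : Euc (n + 1)) 1,
    ω y * f (snocC (xb + |r| • frontC y) (|r| * lastC y + |r|))

/-- The lower average `⟨f⟩⁻_{x̄,r} = ∫_{B_1} ω(y) f(x̄ + |r| ȳ, |r| y_d − |r|) dy`. -/
def avgMinus {n : ℕ} (ω : Euc (n + 1) → ℝ) (f : Euc (n + 1) → ℝ) (xb : Euc n) (r : ℝ) : ℝ :=
  ∫ y in Metric.ball (0 : Euc (n + 1)) 1,
    ω y * f (snocC (xb + |r| • frontC y) (|r| * lastC y - |r|))

open Classical in
/-- The function `u_d(x) = (1/2) sgn(x_d) θ(|x_d|/|x̄|)` (extended by its natural limit value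
`(1/2) sgn(x_d)` on the line `x̄ = 0`). -/
def uD {n : ℕ} (θ : ℝ → ℝ) (x : Euc (n + 1)) : ℝ :=
  if frontC x = 0 then (1 / 2) * Real.sign (lastC x)
  else (1 / 2) * Real.sign (lastC x) * θ (|lastC x| / ‖frontC x‖)

/-- Hypotheses on the profile function `θ`:
smooth on `(0,∞)`, `1_{(1/2,∞)} ≤ θ ≤ 1_{(1/4,∞)}` and `‖θ'‖_∞ ≤ 6`. -/
def IsProfile (θ : ℝ → ℝ) : Prop :=
  ContDiffOn ℝ (⊤ : ℕ∞) θ (Set.Ioi 0) ∧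
    (∀ t : ℝ, 0 < t → (if 1 / 2 < t then (1 : ℝ) else 0) ≤ θ t) ∧
    (∀ t : ℝ, 0 < t → θ t ≤ if 1 / 4 < t then 1 else 0) ∧
    (∀ t : ℝ, 0 < t → |deriv θ t| ≤ 6)

end

lemma aux_tail {l : ℕ → ℝ} (hpos : ∀ j, 0 < l j) (hdec : ∀ j, 2 * l (j + 1) < l j)
    (ε : ℕ → Bool) (N : ℕ) :
    ∃ t, 0 ≤ t ∧ t ≤ l N ∧ gCantorPoint l ε =
      -(1 / 2 : ℝ) + (∑ j ∈ Finset.range N, if ε j then l j - l (j + 1) else 0) + t := by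
  have h0 : ∀ j, 0 ≤ (if ε j then l j - l (j + 1) else 0) := by
    intro j
    split_ifs
    · linarith [hdec j, hpos (j+1)]
    · exact le_rfl
  have h1 : ∀ M n, ∑ i ∈ Finset.range n, (if ε (i + M) then l (i + M) - l (i + M + 1) else 0)
      ≤ l M := by
    intro M n
    have : ∑ i ∈ Finset.range n, (if ε (i + M) then l (i + M) - l (i + M + 1) else 0)
      ≤ l M - l (n + M) := by
      induction n with
      | zero => simp
      | succ n ih =>
        rw [Finset.sum_range_succ]
        have e : n + 1 + M = n + M + 1 := by ring
        rw [e]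
        split_ifs
        · linarith
        · linarith [hdec (n + M), hpos (n + M + 1)]
    linarith [hpos (n + M)]
  have hs : Summable (fun j => if ε j then l j - l (j + 1) else 0) :=
    summable_of_sum_range_le h0 (c := l 0) (fun n => by simpa using h1 0 n)
  refine ⟨∑' i, (if ε (i + N) then l (i + N) - l (i + N + 1) else 0),
    tsum_nonneg (fun i => h0 (i + N)),
    Real.tsum_le_of_sum_range_le (fun i => h0 (i + N)) (h1 N), ?_⟩
  unfold gCantorPoint
  rw [← hs.sum_add_tsum_nat_add N]
  ring

lemma aux_vol {l : ℕ → ℝ} (hpos : ∀ j, 0 < l j) (hdec : ∀ j, 2 * l (j + 1) < l j)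
    (m N : ℕ) {r : ℝ} (hr : 0 < r) (hN : l N ≤ r) :
    volume {xb : Euc m | Metric.infDist xb (gCantorSetPi l m) ≤ r} ≤
      ENNReal.ofReal ((2 ^ N * (5 * r)) ^ m) := by
  set a : (Fin N → Bool) → ℝ := fun w =>
    -(1 / 2 : ℝ) + ∑ j : Fin N, if w j then l j - l (j + 1) else 0 with ha
  set U : Set ℝ := ⋃ w : Fin N → Bool, Set.Icc (a w - 2 * r) (a w + 3 * r) with hU
  have hUvol : volume U ≤ ENNReal.ofReal (2 ^ N * (5 * r)) := by
    calc volume U ≤ ∑ w : Fin N → Bool, volume (Set.Icc (a w - 2 * r) (a w + 3 * r)) :=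
          measure_iUnion_fintype_le _ _
      _ = ∑ w : Fin N → Bool, ENNReal.ofReal (5 * r) := by
          refine Finset.sum_congr rfl (fun w _ => ?_)
          rw [Real.volume_Icc]; congr 1; ring
      _ = ENNReal.ofReal (2 ^ N * (5 * r)) := by
          rw [Finset.sum_const, nsmul_eq_mul, ENNReal.ofReal_mul (by positivity)]
          congr 1
          simp [ENNReal.ofReal_pow]
  have hsub : {xb : Euc m | Metric.infDist xb (gCantorSetPi l m) ≤ r} ⊆
      (WithLp.ofLp : Euc m → (Fin m → ℝ)) ⁻¹' (Set.univ.pi fun _ => U) := by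
    intro x hx i _
    have hne : (gCantorSetPi l m).Nonempty :=
      ⟨WithLp.toLp 2 fun _ => gCantorPoint l fun _ => true, fun i => ⟨fun _ => true, rfl⟩⟩
    have hx' : Metric.infDist x (gCantorSetPi l m) < 2 * r :=
      lt_of_le_of_lt hx (by linarith)
    obtain ⟨y, hy, hxy⟩ := (Metric.infDist_lt_iff hne).1 hx'
    obtain ⟨ε, hε⟩ := hy i
    obtain ⟨t, ht0, ht1, ht⟩ := aux_tail hpos hdec ε N
    have hd : |x i - y i| ≤ 2 * r := by
      have := PiLp.norm_apply_le (x - y) i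
      rw [← dist_eq_norm] at this
      simp only [PiLp.sub_apply, Real.norm_eq_abs] at this
      linarith
    rw [abs_le] at hd
    refine Set.mem_iUnion.2 ⟨fun j => ε j, ?_⟩
    have haw : a (fun j => ε j) = -(1 / 2 : ℝ) +
        ∑ j ∈ Finset.range N, if ε j then l j - l (j + 1) else 0 := by
      simp only [ha]
      rw [Finset.sum_range]
    rw [← haw] at ht
    rw [ht] at hε
    constructor <;> linarith [hd.1, hd.2]
  calc _ ≤ volume ((WithLp.ofLp : Euc m → (Fin m → ℝ)) ⁻¹' (Set.univ.pi fun _ => U)) :=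
        measure_mono hsub
    _ = volume (Set.univ.pi fun _ : Fin m => U) := by
        refine (PiLp.volume_preserving_ofLp (Fin m)).measure_preimage ?_
        refine (MeasurableSet.univ_pi fun _ => ?_).nullMeasurableSet
        exact MeasurableSet.iUnion fun _ => measurableSet_Icc
    _ = volume U ^ m := by
        rw [volume_pi_pi]; simp
    _ ≤ _ := by
        rw [ENNReal.ofReal_pow (by positivity)]
        gcongr

/-- comparison of `N` and the logarithm -/
lemma aux_main {lam gam : ℝ} (hlam0 : 0 < lam) (hlam1 : lam < 1 / 2)
    (l : ℕ → ℝ) (hl : IsCantorLengths lam gam l) :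
    ∃ K : ℝ, 0 < K ∧ ∀ r : ℝ, 0 < r → ∀ n : ℕ, l (n + 1) ≤ r → r < l n →
      r ≤ K * lam ^ n * Real.log (Real.exp 1 + r⁻¹) ^ gam := by
  obtain ⟨h0, hpos, hdec, -, C, hC, hb⟩ := hl
  have h2n : ∀ n, l n * 2 ^ n ≤ 1 := by
    intro n
    induction n with
    | zero => simp [h0]
    | succ n ih =>
      have : 0 < (2:ℝ) ^ n := by positivity
      rw [pow_succ]
      nlinarith [hdec n]
  -- first: l n ≤ K1 lam^n (n+1)^gam
  have hK1 : ∃ K1 : ℝ, 0 < K1 ∧ ∀ n : ℕ, l n ≤ K1 * lam ^ n * ((n : ℝ) + 1) ^ gam := by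
    refine ⟨C * 2 ^ |gam|, by positivity, fun n => ?_⟩
    have h2 : (1 : ℝ) ≤ 2 ^ |gam| := Real.one_le_rpow (by norm_num) (abs_nonneg _)
    rcases Nat.eq_zero_or_pos n with rfl | hn
    · simp only [h0, pow_zero, Nat.cast_zero, zero_add, Real.one_rpow, mul_one]
      nlinarith
    · have hn' : (1 : ℝ) ≤ n := by exact_mod_cast hn
      have key : (n : ℝ) ^ gam ≤ 2 ^ |gam| * ((n : ℝ) + 1) ^ gam := by
        rcases le_total 0 gam with hg | hg
        · have : (n : ℝ) ^ gam ≤ ((n : ℝ) + 1) ^ gam :=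
            Real.rpow_le_rpow (by positivity) (by linarith) hg
          have h3 : 0 ≤ ((n : ℝ) + 1) ^ gam := by positivity
          nlinarith
        · have : (2 * (n : ℝ)) ^ gam ≤ ((n : ℝ) + 1) ^ gam :=
            Real.rpow_le_rpow_of_nonpos (by positivity) (by linarith) hg
          rw [Real.mul_rpow (by norm_num) (by positivity)] at this
          rw [abs_of_nonpos hg]
          calc (n : ℝ) ^ gam = 2 ^ (-gam) * (2 ^ gam * (n : ℝ) ^ gam) := by
                rw [← mul_assoc, ← Real.rpow_add (by norm_num)]; simp
            _ ≤ _ := by gcongr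
      calc l n ≤ C * lam ^ n * (n : ℝ) ^ gam := (hb n hn).2
        _ ≤ C * lam ^ n * (2 ^ |gam| * ((n : ℝ) + 1) ^ gam) := by gcongr
        _ = _ := by ring
  obtain ⟨K1, hK1, hln⟩ := hK1
  have hlog2 : 0 < Real.log 2 := Real.log_pos (by norm_num)
  set c1 : ℝ := Real.log 2 / 2 with hc1
  have hc1p : 0 < c1 := by positivity
  have hloglam : 0 < Real.log lam⁻¹ := by
    apply Real.log_pos
    rw [one_lt_inv₀ hlam0]; linarith
  set A : ℝ := Real.log lam⁻¹ + |gam| with hA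
  have hAp : 0 < A := by positivity
  have hlogC : 0 < Real.log (Real.exp 1 + C) := by
    apply Real.log_pos
    linarith [Real.exp_pos 1]
  set c2 : ℝ := Real.log (Real.exp 1 + C) + A with hc2
  have hc2p : 0 < c2 := by positivity
  refine ⟨K1 * (c1 ^ (-gam) + c2 ^ (-gam)), by positivity, ?_⟩
  intro r hr n hn1 hn2
  set L := Real.log (Real.exp 1 + r⁻¹) with hL
  have hri : 0 < r⁻¹ := by positivity
  have hL1 : 1 ≤ L := by
    rw [hL, Real.le_log_iff_exp_le (by positivity)]; linarith
  have hLn : n * Real.log 2 ≤ L := by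
    rw [← Real.log_pow]
    apply Real.log_le_log (by positivity)
    have : r * 2 ^ n ≤ 1 := le_trans (by gcongr) (h2n n)
    have : (2:ℝ) ^ n ≤ r⁻¹ := by
      rw [le_inv_comm₀ (by positivity) hr, ← one_div, le_div_iff₀ (by positivity)]
      exact this
    linarith [Real.exp_pos 1]
  have hlow : c1 * ((n : ℝ) + 1) ≤ L := by
    have : Real.log 2 ≤ 1 := by linarith [Real.log_two_lt_d9]
    rw [hc1]; linarith
  have hup : L ≤ c2 * ((n : ℝ) + 1) := by
    rw [hL, Real.log_le_iff_le_exp (by positivity)]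
    have hb1 := (hb (n + 1) (by omega)).1
    have hN : (0:ℝ) < (n:ℝ) + 1 := by positivity
    have hNpow : ((n : ℝ) + 1) ^ (-gam) ≤ Real.exp (|gam| * ((n:ℝ) + 1)) := by
      rw [Real.rpow_def_of_pos hN]
      apply Real.exp_le_exp.2
      have hl0 : 0 ≤ Real.log ((n:ℝ) + 1) := Real.log_nonneg (by linarith [Nat.cast_nonneg (α := ℝ) n])
      have hl1 : Real.log ((n:ℝ) + 1) ≤ (n:ℝ) + 1 := by
        linarith [Real.log_le_sub_one_of_pos hN]
      calc Real.log ((n:ℝ) + 1) * (-gam) ≤ Real.log ((n:ℝ) + 1) * |gam| := by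
            gcongr; exact neg_le_abs gam
        _ ≤ ((n:ℝ) + 1) * |gam| := by gcongr
        _ = _ := by ring
    have hlamN : (lam⁻¹) ^ (n + 1) = Real.exp (Real.log lam⁻¹ * ((n:ℝ) + 1)) := by
      rw [mul_comm, ← Real.log_rpow (by positivity), Real.exp_log (by positivity)]
      exact_mod_cast rfl
    have h3 : r⁻¹ ≤ C * Real.exp (A * ((n:ℝ) + 1)) := by
      calc r⁻¹ ≤ (C⁻¹ * lam ^ (n+1) * ((n + 1 : ℕ) : ℝ) ^ gam)⁻¹ := by
            apply inv_anti₀ (by positivity)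
            linarith
        _ = C * ((lam⁻¹) ^ (n + 1) * ((n : ℝ) + 1) ^ (-gam)) := by
            rw [Real.rpow_neg hN.le]
            push_cast
            simp only [mul_inv, inv_inv, inv_pow]
            ring
        _ ≤ C * (Real.exp (Real.log lam⁻¹ * ((n:ℝ) + 1)) * Real.exp (|gam| * ((n:ℝ) + 1))) := by
            rw [hlamN]; gcongr
        _ = _ := by rw [← Real.exp_add, hA]; ring_nf
    have h4 : 1 ≤ Real.exp (A * ((n:ℝ) + 1)) := Real.one_le_exp (by positivity)
    calc Real.exp 1 + r⁻¹ ≤ (Real.exp 1 + C) * Real.exp (A * ((n:ℝ) + 1)) := by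
          nlinarith [Real.exp_pos 1]
      _ ≤ Real.exp (Real.log (Real.exp 1 + C) * ((n:ℝ) + 1)) * Real.exp (A * ((n:ℝ) + 1)) := by
          gcongr
          rw [← Real.log_le_iff_le_exp (by positivity)]
          nlinarith [Nat.cast_nonneg (α := ℝ) n]
      _ = _ := by rw [← Real.exp_add, hc2]; ring_nf
  have hcmp : ((n:ℝ) + 1) ^ gam ≤ (c1 ^ (-gam) + c2 ^ (-gam)) * L ^ gam := by
    have hLg : 0 ≤ L ^ gam := by positivity
    have e1 : 0 ≤ c1 ^ (-gam) * L ^ gam := by positivity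
    have e2 : 0 ≤ c2 ^ (-gam) * L ^ gam := by positivity
    have gen : ∀ c : ℝ, 0 < c → (c * ((n:ℝ) + 1)) ^ gam ≤ L ^ gam →
        ((n:ℝ) + 1) ^ gam ≤ c ^ (-gam) * L ^ gam := by
      intro c hc h
      rw [Real.mul_rpow hc.le (by positivity)] at h
      calc ((n:ℝ) + 1) ^ gam = c ^ (-gam) * (c ^ gam * ((n:ℝ) + 1) ^ gam) := by
            rw [← mul_assoc, ← Real.rpow_add hc]; simp
        _ ≤ _ := by gcongr
    rcases le_total 0 gam with hg | hg
    · linarith [gen c1 hc1p (Real.rpow_le_rpow (by positivity) hlow hg)]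
    · linarith [gen c2 hc2p (Real.rpow_le_rpow_of_nonpos (by linarith) hup hg)]
  calc r ≤ K1 * lam ^ n * ((n : ℝ) + 1) ^ gam := hn2.le.trans (hln n)
    _ ≤ K1 * lam ^ n * ((c1 ^ (-gam) + c2 ^ (-gam)) * L ^ gam) := by gcongr
    _ = _ := by ring

/-- Upper bound for the Lebesgue measure of the `r`-neighborhood of the
Cantor set: `ℒ^m({x̄ : dist(x̄,𝔠^m_{λ,γ}) ≤ r}) ≤ C · r^{m−𝔇} · (log(e + r⁻¹))^{γ𝔇}`. -/
theorem cantor_neighborhood_volume_estimate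
    {d m k : ℕ} (hd : d = m + k) (hd2 : 2 ≤ d) (hm : 1 ≤ m) (hk : 1 ≤ k)
    {lam gam : ℝ} (hlam0 : 0 < lam) (hlam1 : lam < 1 / 2)
    (l : ℕ → ℝ) (hl : IsCantorLengths lam gam l) :
    ∃ C : ℝ, 0 < C ∧ ∀ r : ℝ, 0 < r → r < 1 →
      volume {xb : Euc m | Metric.infDist xb (gCantorSetPi l m) ≤ r} ≤
        ENNReal.ofReal (C * r ^ ((m : ℝ) - frD m lam) *
          Real.log (Real.exp 1 + r⁻¹) ^ (gam * frD m lam)) := by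
  obtain ⟨K, hK, hmain⟩ := aux_main hlam0 hlam1 l hl
  obtain ⟨h0, hpos, hdec, -, -⟩ := hl
  have h2n : ∀ n, l n ≤ (1 / 2 : ℝ) ^ n := by
    intro n
    induction n with
    | zero => simp [h0]
    | succ n ih =>
      rw [pow_succ]
      linarith [hdec n]
  set D := frD m lam with hD
  have hloglam : 0 < Real.log lam⁻¹ := by
    apply Real.log_pos
    rw [one_lt_inv₀ hlam0]; linarith
  have hlog2 : 0 < Real.log 2 := Real.log_pos (by norm_num)
  have hDp : 0 ≤ D := by rw [hD, frD]; positivity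
  have hlamD : lam ^ D = ((2:ℝ) ^ m)⁻¹ := by
    rw [Real.rpow_def_of_pos hlam0, ← Real.exp_log (show (0:ℝ) < ((2:ℝ) ^ m)⁻¹ by positivity)]
    congr 1
    rw [Real.log_inv, Real.log_pow, hD, frD]
    rw [Real.log_inv] at hloglam ⊢
    have : Real.log lam ≠ 0 := by linarith
    field_simp
  refine ⟨10 ^ m * K ^ D, by positivity, ?_⟩
  intro r hr hr1
  have hex : ∃ N, l N ≤ r := by
    obtain ⟨N, hN⟩ := exists_pow_lt_of_lt_one hr (show (1 / 2 : ℝ) < 1 by norm_num)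
    exact ⟨N, (h2n N).trans hN.le⟩
  classical
  have hNs := Nat.find_spec hex
  have hNm := fun k => Nat.find_min hex (m := k)
  obtain ⟨n, hn⟩ : ∃ n, Nat.find hex = n + 1 := by
    refine Nat.exists_eq_succ_of_ne_zero ?_
    intro h
    rw [h, h0] at hNs
    linarith
  rw [hn] at hNs hNm
  have hn2 : r < l n := not_le.1 (hNm n (Nat.lt_succ_self n))
  have h := hmain r hr n hNs hn2
  refine (aux_vol hpos hdec m (n + 1) hr hNs).trans (ENNReal.ofReal_le_ofReal ?_)
  set L := Real.log (Real.exp 1 + r⁻¹) with hL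
  have hri : 0 < r⁻¹ := by positivity
  have hL1 : 0 < L := by
    apply Real.log_pos
    linarith [Real.add_one_le_exp (1:ℝ)]
  have h5 : r ^ D ≤ K ^ D * ((2:ℝ) ^ (n * m))⁻¹ * L ^ (gam * D) := by
    have := Real.rpow_le_rpow hr.le h hDp
    rw [Real.mul_rpow (by positivity) (by positivity), Real.mul_rpow hK.le (by positivity),
      ← Real.rpow_mul hL1.le, ← Real.rpow_natCast lam n, ← Real.rpow_mul hlam0.le,
      mul_comm (n:ℝ) D, Real.rpow_mul hlam0.le, hlamD, Real.rpow_natCast, inv_pow, ← pow_mul,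
      mul_comm m n] at this
    exact this
  have h6 : (2:ℝ) ^ (n * m) ≤ K ^ D * r ^ (-D) * L ^ (gam * D) := by
    have hrD : 0 < r ^ D := by positivity
    rw [Real.rpow_neg hr.le]
    have hp : 0 < (2:ℝ) ^ (n * m) := by positivity
    calc (2:ℝ) ^ (n * m) = 2 ^ (n * m) * (r ^ D)⁻¹ * r ^ D := by field_simp
      _ ≤ 2 ^ (n * m) * (r ^ D)⁻¹ * (K ^ D * ((2:ℝ) ^ (n * m))⁻¹ * L ^ (gam * D)) := by gcongr
      _ = _ := by field_simp
  calc ((2:ℝ) ^ (n + 1) * (5 * r)) ^ m = 10 ^ m * 2 ^ (n * m) * r ^ m := by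
        rw [pow_mul, ← mul_pow, ← mul_pow]; congr 1; ring
    _ ≤ 10 ^ m * (K ^ D * r ^ (-D) * L ^ (gam * D)) * r ^ m := by gcongr
    _ = _ := by
        rw [sub_eq_add_neg, Real.rpow_add hr, Real.rpow_natCast]; ring
end

section
/- Let d ≥ 2 and let θ ∈ C^∞((0,∞)) satisfy 1_{(1/2,∞)} ≤ θ ≤ 1_{(1/4,∞)} and ‖θ'‖_∞ ≤ 6. Define u_d on ℝ^d, writing x = (x̄, x_d) ∈ ℝ^{d−1} × ℝ, by u_d(x) = (1/2) sgn(x_d) θ(|x_d|/|x̄|). Then u_d ∈ L^∞(ℝ^d) ∩ W^{1,1}_loc(ℝ^d) ∩ C^∞(ℝ^d \ {0}), and there is a constant C = C(d) such that |∇u_d(x)| ≤ C |x_d|^{−1} · 1_{{2|x_d| ≤ |x̄| ≤ 4|x_d|}} for all x ≠ 0 (note that on this set |x_d|^{−1} and |x̄|^{−1} are comparable). -/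
open MeasureTheory Real Set Metric Filter Topology NNReal ENNReal

theorem aux_integral_fderiv_zero {n : ℕ} (hn : 1 ≤ n) (w : Euc (n+1) → ℝ)
    (hw : ContDiffOn ℝ 1 w {0}ᶜ) (hc : HasCompactSupport w) (M : ℝ) (hM : ∀ x, |w x| ≤ M)
    (hint : Integrable (fun x => fderiv ℝ w x)) : ∫ x, fderiv ℝ w x = 0 := by
  let b : ContDiffBump (0 : Euc (n+1)) := ⟨1, 2, by norm_num, by norm_num⟩
  let η : Euc (n+1) → ℝ := fun x => 1 - b x
  have hη : ContDiff ℝ 1 η := contDiff_const.sub b.contDiff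
  have hη0 : ∀ x ∈ ball (0 : Euc (n+1)) 1, η x = 0 := by
    intro x hx
    have : b x = 1 := b.one_of_mem_closedBall (ball_subset_closedBall hx)
    simp [η, this]
  have hη1 : ∀ x, 2 < ‖x‖ → η x = 1 := by
    intro x hx
    have : b x = 0 := b.zero_of_le_dist (by simpa using hx.le)
    simp [η, this]
  have hηb : ∀ x, |η x| ≤ 1 := by
    intro x
    have h1 := b.nonneg' x
    have h2 : b x ≤ 1 := b.le_one
    simp only [η]; rw [abs_le]; constructor <;> linarith
  have hη1' : ∀ x, 2 < ‖x‖ → fderiv ℝ η x = 0 := by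
    intro x hx
    have : η =ᶠ[𝓝 x] fun _ => 1 := by
      filter_upwards [(isOpen_lt continuous_const continuous_norm).mem_nhds hx] with y hy
      exact hη1 y hy
    rw [this.fderiv_eq]; simp
  have hηc : Continuous (fderiv ℝ η) := hη.continuous_fderiv one_ne_zero
  obtain ⟨D, hD⟩ : ∃ D, ∀ x, ‖fderiv ℝ η x‖ ≤ D := by
    obtain ⟨D, hD⟩ := (isCompact_closedBall (0 : Euc (n+1)) 2).exists_bound_of_continuousOn
      hηc.continuousOn
    refine ⟨max D 0, fun x => ?_⟩
    by_cases hx : ‖x‖ ≤ 2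
    · exact (hD x (by simpa using hx)).trans (le_max_left _ _)
    · rw [hη1' x (by linarith)]; simp
  have hD0 : 0 ≤ D := (norm_nonneg _).trans (hD 0)
  have hDx : ∀ x, ‖x‖ * ‖fderiv ℝ η x‖ ≤ 2 * D := by
    intro x
    by_cases hx : ‖x‖ ≤ 2
    · exact mul_le_mul hx (hD x) (norm_nonneg _) (by norm_num)
    · rw [hη1' x (by linarith)]; simp; exact hD0
  let ηk : ℕ → Euc (n+1) → ℝ := fun k x => η (((k:ℝ)+1) • x)
  have hkf : ∀ k x, fderiv ℝ (ηk k) x = ((k:ℝ)+1) • fderiv ℝ η (((k:ℝ)+1) • x) := by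
    intro k x; exact fderiv_comp_smul _
  have hkC : ∀ k, ContDiff ℝ 1 (ηk k) := fun k => hη.comp (contDiff_const_smul _)
  have hkb : ∀ k x, x ≠ 0 → ‖fderiv ℝ (ηk k) x‖ ≤ 2 * D * ‖x‖⁻¹ := by
    intro k x hx
    have hx' : 0 < ‖x‖ := norm_pos_iff.2 hx
    have h := hDx (((k:ℝ)+1) • x)
    have hk : (0:ℝ) < k + 1 := by positivity
    rw [hkf, norm_smul]
    rw [norm_smul] at h
    rw [← div_eq_mul_inv, le_div_iff₀ hx']
    linarith
  let g : ℕ → Euc (n+1) → ℝ := fun k x => ηk k x * w x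
  have hgC : ∀ k, ContDiff ℝ 1 (g k) := by
    intro k
    rw [contDiff_iff_contDiffAt]
    intro x
    by_cases hx : x = 0
    · subst hx
      have : g k =ᶠ[𝓝 0] fun _ => 0 := by
        have : ∀ᶠ y in 𝓝 (0 : Euc (n+1)), ((k:ℝ)+1) • y ∈ ball (0 : Euc (n+1)) 1 := by
          have hcont : Continuous fun y : Euc (n+1) => ((k:ℝ)+1) • y := continuous_const_smul _
          exact hcont.continuousAt.eventually_mem (isOpen_ball.mem_nhds (by simp))
        filter_upwards [this] with y hy
        simp only [g, ηk, hη0 _ hy, zero_mul]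
      exact contDiffAt_const.congr_of_eventuallyEq this
    · exact (hkC k).contDiffAt.mul (hw.contDiffAt (isOpen_compl_singleton.mem_nhds hx))
  have hgc : ∀ k, HasCompactSupport (g k) := fun k => hc.mul_left
  have hgi : ∀ k, Integrable (fun x => fderiv ℝ (g k) x) := fun k =>
    ((hgC k).continuous_fderiv one_ne_zero).integrable_of_hasCompactSupport ((hgc k).fderiv ℝ)
  have hg0 : ∀ k, ∫ x, fderiv ℝ (g k) x = 0 := by
    intro k
    ext v
    rw [ContinuousLinearMap.integral_apply (hgi k)]
    have hi : Integrable (fun x => fderiv ℝ (g k) x v) :=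
      (hgi k).apply_continuousLinearMap v
    have := integral_mul_fderiv_eq_neg_fderiv_mul_of_integrable (μ := volume) (𝕜 := ℝ)
      (f := fun _ : Euc (n+1) => (1:ℝ)) (g := g k) (v := v) (by simp) (by simpa using hi)
      (by simpa using (hgC k).continuous.integrable_of_hasCompactSupport (hgc k))
      (fun x _ => by fun_prop) (fun x _ => (hgC k).differentiable one_ne_zero x)
    simpa using this
  have hne : ∀ᵐ x : Euc (n+1), x ≠ 0 := by
    simp [ae_iff]
  have hgd : ∀ k x, x ≠ 0 → fderiv ℝ (g k) x = ηk k x • fderiv ℝ w x + w x • fderiv ℝ (ηk k) x := by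
    intro k x hx
    exact fderiv_mul ((hkC k).differentiable one_ne_zero x)
      ((hw.contDiffAt (isOpen_compl_singleton.mem_nhds hx)).differentiableAt one_ne_zero)
  have hwm : AEStronglyMeasurable w volume := by
    have h1 : AEStronglyMeasurable w (volume.restrict {0}ᶜ) :=
      hw.continuousOn.aestronglyMeasurable (measurableSet_singleton _).compl
    have h2 : (volume.restrict ({0}ᶜ : Set (Euc (n+1)))) = volume := by
      rw [Measure.restrict_eq_self_of_ae_mem]; exact hne
    rwa [h2] at h1
  have hM0 : 0 ≤ M := (abs_nonneg _).trans (hM 0)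
  have hwi : Integrable (fun x => |w x| * (2 * D * ‖x‖⁻¹)) := by
    have hl : LocallyIntegrable (fun x => |w x| * (2 * D * ‖x‖⁻¹)) := by
      refine locallyIntegrable_of_norm_le_rpow (C := M * (2 * D)) (α := 1) (by simp) (by simp; omega)
        (ae_of_all _ fun x => ?_) ?_
      · rw [Real.rpow_neg_one, Real.norm_of_nonneg (by positivity), mul_assoc M]
        gcongr; exact hM x
      · exact hwm.norm.mul (by fun_prop)
    have hs : HasCompactSupport (fun x => |w x| * (2 * D * ‖x‖⁻¹)) := by
      refine hc.mono fun x hx hx' => hx ?_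
      simp [hx']
    refine (integrableOn_iff_integrable_of_support_subset (subset_tsupport _)).1
      (hl.integrableOn_isCompact hs)
  have hlim := tendsto_integral_of_dominated_convergence (F := fun k x => fderiv ℝ (g k) x)
    (f := fun x => fderiv ℝ w x) (μ := volume)
    (fun x => ‖fderiv ℝ w x‖ + |w x| * (2 * D * ‖x‖⁻¹))
    (fun k => (hgi k).1) (hint.norm.add hwi)
    (fun k => by
      filter_upwards [hne] with x hx
      rw [hgd k x hx]
      refine (norm_add_le _ _).trans ?_
      rw [norm_smul, norm_smul]
      have h1 : ‖ηk k x‖ ≤ 1 := hηb _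
      have h2 := hkb k x hx
      rw [Real.norm_eq_abs (w x)]
      gcongr
      exact mul_le_of_le_one_left (norm_nonneg _) h1)
    (by
      filter_upwards [hne] with x hx
      have hx' : 0 < ‖x‖ := norm_pos_iff.2 hx
      refine tendsto_const_nhds.congr' ?_
      filter_upwards [eventually_gt_atTop (Nat.ceil (2 / ‖x‖))] with k hk
      have hk1 : 2 / ‖x‖ < k + 1 := (Nat.lt_of_ceil_lt hk).trans (by linarith)
      have h2 : 2 < ‖((k:ℝ)+1) • x‖ := by
        rw [norm_smul, Real.norm_of_nonneg (by positivity)]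
        rwa [div_lt_iff₀ hx'] at hk1
      rw [hgd k x hx, hkf, hη1' _ h2]
      simp only [ηk, hη1 _ h2]; simp)
  simp only [hg0] at hlim
  exact (tendsto_nhds_unique hlim tendsto_const_nhds)

noncomputable def lastL (n : ℕ) : Euc (n+1) →L[ℝ] ℝ := EuclideanSpace.proj (Fin.last n)

noncomputable def frontL (n : ℕ) : Euc (n+1) →L[ℝ] Euc n :=
  LinearMap.toContinuousLinearMap
    { toFun := frontC
      map_add' := fun x y => by ext i; simp [frontC]
      map_smul' := fun c x => by ext i; simp [frontC] }

theorem lastL_apply {n : ℕ} (x : Euc (n+1)) : lastL n x = lastC x := rfl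
theorem frontL_apply {n : ℕ} (x : Euc (n+1)) : frontL n x = frontC x := rfl

theorem norm_sq_split {n : ℕ} (x : Euc (n+1)) : ‖x‖^2 = ‖frontC x‖^2 + |lastC x|^2 := by
  rw [EuclideanSpace.norm_sq_eq, EuclideanSpace.norm_sq_eq, Fin.sum_univ_castSucc]
  simp [frontC, lastC]

theorem norm_frontC_le {n : ℕ} (x : Euc (n+1)) : ‖frontC x‖ ≤ ‖x‖ := by
  have := norm_sq_split x
  exact (sq_le_sq₀ (norm_nonneg _) (norm_nonneg _)).1 (by nlinarith [sq_nonneg |lastC x|])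

theorem abs_lastC_le {n : ℕ} (x : Euc (n+1)) : |lastC x| ≤ ‖x‖ := by
  have := norm_sq_split x
  exact (sq_le_sq₀ (abs_nonneg _) (norm_nonneg _)).1 (by nlinarith [sq_nonneg ‖frontC x‖])

theorem norm_le_split {n : ℕ} (x : Euc (n+1)) : ‖x‖ ≤ ‖frontC x‖ + |lastC x| := by
  have := norm_sq_split x
  have h1 := norm_nonneg (frontC x)
  have h2 := abs_nonneg (lastC x)
  exact (sq_le_sq₀ (norm_nonneg _) (by positivity)).1 (by nlinarith [mul_nonneg h1 h2])

theorem continuous_lastC {n : ℕ} : Continuous (lastC (n := n)) := (lastL n).continuous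
theorem continuous_frontC {n : ℕ} : Continuous (frontC (n := n)) := (frontL n).continuous

theorem prof_bd {θ : ℝ → ℝ} (hθ : IsProfile θ) {t : ℝ} (ht : 0 < t) : 0 ≤ θ t ∧ θ t ≤ 1 := by
  obtain ⟨-, h1, h2, -⟩ := hθ
  constructor
  · refine le_trans ?_ (h1 t ht); split_ifs <;> norm_num
  · refine (h2 t ht).trans ?_; split_ifs <;> norm_num

theorem prof_zero {θ : ℝ → ℝ} (hθ : IsProfile θ) {t : ℝ} (ht : 0 < t) (h : t ≤ 1/4) : θ t = 0 := by
  have h2 := hθ.2.2.1 t ht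
  rw [if_neg (not_lt.2 h)] at h2
  exact le_antisymm h2 (prof_bd hθ ht).1

theorem prof_one {θ : ℝ → ℝ} (hθ : IsProfile θ) {t : ℝ} (h : 1/2 < t) : θ t = 1 := by
  have ht : 0 < t := by linarith
  have h2 := hθ.2.1 t ht
  rw [if_pos h] at h2
  exact le_antisymm (prof_bd hθ ht).2 h2

theorem sign_abs_le (t : ℝ) : |Real.sign t| ≤ 1 := by
  rcases Real.sign_apply_eq t with h | h | h <;> simp [h]

theorem uD_bd {n : ℕ} {θ : ℝ → ℝ} (hθ : IsProfile θ) (x : Euc (n+1)) : |uD θ x| ≤ 1 := by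
  unfold uD
  have hs := sign_abs_le (lastC x)
  split_ifs with h
  · rw [abs_mul, abs_of_pos (by norm_num : (0:ℝ) < 1/2)]; linarith
  · by_cases hl : lastC x = 0
    · simp [hl]
    · have ht : 0 < |lastC x| / ‖frontC x‖ := div_pos (abs_pos.2 hl) (norm_pos_iff.2 h)
      obtain ⟨h1, h2⟩ := prof_bd hθ ht
      rw [abs_mul, abs_mul, abs_of_pos (by norm_num : (0:ℝ) < 1/2), abs_of_nonneg h1]
      nlinarith [abs_nonneg (Real.sign (lastC x))]

theorem sign_loc {a b : ℝ} (hab : 0 < Real.sign a * b) :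
    Real.sign b = Real.sign a ∧ |b| = Real.sign a * b := by
  rcases lt_trichotomy a 0 with h | h | h
  · rw [Real.sign_of_neg h] at hab ⊢
    have : b < 0 := by linarith
    rw [Real.sign_of_neg this, abs_of_neg this]; simp
  · simp [h] at hab
  · rw [Real.sign_of_pos h] at hab ⊢
    have : 0 < b := by linarith
    rw [Real.sign_of_pos this, abs_of_pos this]; simp

theorem sign_mul_self' {a : ℝ} (h : a ≠ 0) : Real.sign a * a = |a| := by
  rcases lt_or_gt_of_ne h with h | h
  · rw [Real.sign_of_neg h, abs_of_neg h]; simp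
  · rw [Real.sign_of_pos h, abs_of_pos h]; simp

theorem uD_caseA {n : ℕ} {θ : ℝ → ℝ} (hθ : IsProfile θ) (x : Euc (n+1))
    (h : 4 * |lastC x| < ‖frontC x‖) : uD θ =ᶠ[𝓝 x] fun _ => 0 := by
  have ho : IsOpen {y : Euc (n+1) | 4 * |lastC y| < ‖frontC y‖} :=
    isOpen_lt (continuous_const.mul continuous_lastC.abs) continuous_frontC.norm
  filter_upwards [ho.mem_nhds h] with y (hy : 4 * |lastC y| < ‖frontC y‖)
  have hp : 0 < ‖frontC y‖ := lt_of_le_of_lt (by positivity) hy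
  unfold uD
  rw [if_neg (norm_pos_iff.1 hp)]
  by_cases hl : lastC y = 0
  · simp [hl]
  · rw [prof_zero hθ (div_pos (abs_pos.2 hl) hp) (by rw [div_le_iff₀ hp]; linarith)]; simp

theorem uD_caseB {n : ℕ} {θ : ℝ → ℝ} (hθ : IsProfile θ) (x : Euc (n+1))
    (h : ‖frontC x‖ < 2 * |lastC x|) :
    uD θ =ᶠ[𝓝 x] fun _ => (1/2) * Real.sign (lastC x) := by
  have ho : IsOpen {y : Euc (n+1) | ‖frontC y‖ < 2 * |lastC y|} :=
    isOpen_lt continuous_frontC.norm (continuous_const.mul continuous_lastC.abs)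
  have ho2 : IsOpen {y : Euc (n+1) | 0 < Real.sign (lastC x) * lastC y} :=
    isOpen_lt continuous_const (continuous_const.mul continuous_lastC)
  have hl : lastC x ≠ 0 := by
    intro hl; rw [hl] at h; simp at h; linarith [norm_nonneg (frontC x)]
  have hx2 : 0 < Real.sign (lastC x) * lastC x := by
    rw [sign_mul_self' hl]; exact abs_pos.2 hl
  filter_upwards [ho.mem_nhds h, ho2.mem_nhds hx2] with y
    (hy : ‖frontC y‖ < 2 * |lastC y|) (hy2 : 0 < Real.sign (lastC x) * lastC y)
  unfold uD
  rw [(sign_loc hy2).1]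
  split_ifs with h0
  · rfl
  · have hp : 0 < ‖frontC y‖ := norm_pos_iff.2 h0
    rw [prof_one hθ (by rw [lt_div_iff₀ hp]; linarith)]; simp

theorem uD_caseC {n : ℕ} (θ : ℝ → ℝ) (x : Euc (n+1))
    (hl : lastC x ≠ 0) (hf : frontC x ≠ 0) :
    uD θ =ᶠ[𝓝 x] fun y => (1/2 * Real.sign (lastC x)) *
      θ (Real.sign (lastC x) * lastL n y * ‖frontL n y‖⁻¹) := by
  have ho : IsOpen {y : Euc (n+1) | frontC y ≠ 0} :=
    isOpen_ne_fun continuous_frontC continuous_const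
  have ho2 : IsOpen {y : Euc (n+1) | 0 < Real.sign (lastC x) * lastC y} :=
    isOpen_lt continuous_const (continuous_const.mul continuous_lastC)
  have hx2 : 0 < Real.sign (lastC x) * lastC x := by
    rw [sign_mul_self' hl]; exact abs_pos.2 hl
  filter_upwards [ho.mem_nhds hf, ho2.mem_nhds hx2] with y
    (hy : frontC y ≠ 0) (hy2 : 0 < Real.sign (lastC x) * lastC y)
  unfold uD
  rw [(sign_loc hy2).1, (sign_loc hy2).2, if_neg hy, lastL_apply, frontL_apply,
    div_eq_mul_inv (Real.sign (lastC x) * lastC y)]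

theorem arg_pos {n : ℕ} (x : Euc (n+1)) (hl : lastC x ≠ 0) (hf : frontC x ≠ 0) :
    0 < Real.sign (lastC x) * lastL n x * ‖frontL n x‖⁻¹ := by
  rw [lastL_apply, frontL_apply, sign_mul_self' hl]
  have := norm_pos_iff.2 hf
  have := abs_pos.2 hl
  positivity

theorem uD_smooth {n : ℕ} {θ : ℝ → ℝ} (hθ : IsProfile θ) (x : Euc (n+1)) (hx : x ≠ 0) :
    ContDiffAt ℝ (⊤ : ℕ∞) (uD θ) x := by
  by_cases hA : 4 * |lastC x| < ‖frontC x‖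
  · exact contDiffAt_const.congr_of_eventuallyEq (uD_caseA hθ x hA)
  by_cases hB : ‖frontC x‖ < 2 * |lastC x|
  · exact contDiffAt_const.congr_of_eventuallyEq (uD_caseB hθ x hB)
  push Not at hA hB
  have hxn := norm_pos_iff.2 hx
  have hns := norm_le_split x
  have hl : lastC x ≠ 0 := by intro h; rw [h] at hA hns; simp at hA hns; simp [hA] at hns; exact hx hns
  have hf : frontC x ≠ 0 := by
    intro h; rw [h, norm_zero] at hB; linarith [abs_pos.2 hl]
  refine ContDiffAt.congr_of_eventuallyEq ?_ (uD_caseC θ x hl hf)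
  have hθx := hθ.1.contDiffAt (Ioi_mem_nhds (arg_pos x hl hf))
  refine contDiffAt_const.mul (hθx.comp x ?_)
  have h1 : ContDiffAt ℝ (⊤ : ℕ∞) (fun y => ‖frontL n y‖) x :=
    ((frontL n).contDiff.contDiffAt).norm ℝ hf
  exact (contDiffAt_const.mul (lastL n).contDiff.contDiffAt).mul (h1.inv (norm_ne_zero_iff.2 hf))

theorem uD_grad {n : ℕ} {θ : ℝ → ℝ} (hθ : IsProfile θ) (x : Euc (n+1)) (hx : x ≠ 0) :
    ‖fderiv ℝ (uD θ) x‖ ≤ 3 * |lastC x|⁻¹ *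
        (if 2 * |lastC x| ≤ ‖frontC x‖ ∧ ‖frontC x‖ ≤ 4 * |lastC x| then 1 else 0) := by
  by_cases hA : 4 * |lastC x| < ‖frontC x‖
  · rw [(uD_caseA hθ x hA).fderiv_eq]; simp; positivity
  by_cases hB : ‖frontC x‖ < 2 * |lastC x|
  · rw [(uD_caseB hθ x hB).fderiv_eq]; simp; positivity
  push Not at hA hB
  have hxn := norm_pos_iff.2 hx
  have hns := norm_le_split x
  have hl : lastC x ≠ 0 := by intro h; rw [h] at hA hns; simp at hA hns; simp [hA] at hns; exact hx hns
  have hf : frontC x ≠ 0 := by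
    intro h; rw [h, norm_zero] at hB; linarith [abs_pos.2 hl]
  rw [if_pos ⟨hB, hA⟩, mul_one, (uD_caseC θ x hl hf).fderiv_eq]
  have hp := arg_pos x hl hf
  have hθx := ((hθ.1.contDiffAt (Ioi_mem_nhds hp)).differentiableAt (by simp)).hasDerivAt
  have hN1 : ContDiffAt ℝ (⊤ : ℕ∞) (fun y => ‖frontL n y‖) x :=
    ((frontL n).contDiff.contDiffAt).norm ℝ hf
  have hN := (hN1.differentiableAt (by simp)).hasFDerivAt
  have hNb : ‖fderiv ℝ (fun y => ‖frontL n y‖) x‖ ≤ 1 := by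
    refine norm_fderiv_le_of_lip' ℝ zero_le_one (Eventually.of_forall fun y => ?_)
    rw [one_mul]
    refine (abs_norm_sub_norm_le _ _).trans ?_
    rw [← map_sub]; exact norm_frontC_le _
  have hLb : ‖lastL n‖ ≤ 1 :=
    ContinuousLinearMap.opNorm_le_bound _ zero_le_one fun y => by
      rw [one_mul]; exact abs_lastC_le y
  set s := Real.sign (lastC x) with hs
  have hsb : |s| ≤ 1 := sign_abs_le _
  have hinv := (hasDerivAt_inv (norm_ne_zero_iff.2 hf)).comp_hasFDerivAt x hN
  have hL := ((lastL n).hasFDerivAt (x := x)).const_mul s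
  have hall := (hθx.comp_hasFDerivAt x (hL.mul hinv)).const_mul (1/2 * s)
  have hall2 : fderiv ℝ (fun y => (1/2 * s) * θ (s * lastL n y * ‖frontL n y‖⁻¹)) x = _ :=
    hall.fderiv
  rw [hall2]
  have hd := hθ.2.2.2 _ hp
  have hfp := norm_pos_iff.2 hf
  have hlp := abs_pos.2 hl
  simp only [norm_smul, Real.norm_eq_abs]
  have key : ‖(s * lastL n x) • (-(‖frontL n x‖ ^ 2)⁻¹ • fderiv ℝ (fun y => ‖frontL n y‖) x) +
      (‖frontL n x‖⁻¹) • (s • lastL n)‖ ≤ |lastC x|⁻¹ := by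
    refine (norm_add_le _ _).trans ?_
    simp only [norm_smul, Real.norm_eq_abs, abs_mul, abs_neg, abs_inv, abs_pow, abs_norm,
      lastL_apply, frontL_apply]
    have e1 : |s| * |lastC x| * ((‖frontC x‖^2)⁻¹ * ‖fderiv ℝ (fun y => ‖frontL n y‖) x‖)
        ≤ 1 * |lastC x| * (((2 * |lastC x|)^2)⁻¹ * 1) := by
      gcongr
    have e2 : ‖frontC x‖⁻¹ * (|s| * ‖lastL n‖) ≤ (2 * |lastC x|)⁻¹ * (1 * 1) := by
      gcongr
    have e3 : 1 * |lastC x| * (((2 * |lastC x|)^2)⁻¹ * 1) = |lastC x|⁻¹ / 4 := by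
      field_simp; norm_num
    have e4 : (2 * |lastC x|)⁻¹ * (1 * 1) = |lastC x|⁻¹ / 2 := by
      field_simp
    have : 0 < |lastC x|⁻¹ := by positivity
    simp only [frontL_apply] at e1
    linarith
  calc _ ≤ |1/2 * s| * (6 * |lastC x|⁻¹) := by
        gcongr
        exact key
    _ ≤ (1/2) * (6 * |lastC x|⁻¹) := by
        gcongr
        rw [abs_mul, abs_of_pos (by norm_num : (0:ℝ) < 1/2)]; linarith
    _ = _ := by ring

/-- Properties of the function `u_d(x) = (1/2) sgn(x_d) θ(|x_d|/|x̄|)`: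
it is bounded, lies in `W^{1,1}_loc(ℝ^d)`, is smooth away from the origin, and its gradient
satisfies `|∇u_d| ≤ C |x_d|⁻¹ 1_{2|x_d| ≤ |x̄| ≤ 4|x_d|}`. -/
theorem uD_properties
    {n : ℕ} (hn : 1 ≤ n) (θ : ℝ → ℝ) (hθ : IsProfile θ)
    (u : Euc (n + 1) → ℝ) (hu : u = uD θ) :
    (∃ M : ℝ, ∀ x, |u x| ≤ M) ∧
    LocallyIntegrable u volume ∧
    LocallyIntegrable (fun x => fderiv ℝ u x) volume ∧
    HasWeakFDerivOn Set.univ u (fun x => fderiv ℝ u x) ∧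
    ContDiffOn ℝ (⊤ : ℕ∞) u {(0 : Euc (n + 1))}ᶜ ∧
    ∃ C : ℝ, 0 < C ∧ ∀ x : Euc (n + 1), x ≠ 0 →
      ‖fderiv ℝ u x‖ ≤ C * |lastC x|⁻¹ *
        (if 2 * |lastC x| ≤ ‖frontC x‖ ∧ ‖frontC x‖ ≤ 4 * |lastC x| then 1 else 0) := by
  have hb : ∀ x, |u x| ≤ 1 := by rw [hu]; exact uD_bd hθ
  have hsm : ∀ x, x ≠ 0 → ContDiffAt ℝ (⊤ : ℕ∞) u x := by rw [hu]; exact uD_smooth hθ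
  have hgr := uD_grad (n := n) hθ
  rw [← hu] at hgr
  have hco : ContDiffOn ℝ (⊤ : ℕ∞) u {(0 : Euc (n + 1))}ᶜ :=
    fun x hx => (hsm x hx).contDiffWithinAt
  have hne : ∀ᵐ x : Euc (n+1), x ≠ 0 := by
    simp [ae_iff]
  have hum : AEStronglyMeasurable u volume := by
    have h1 : AEStronglyMeasurable u (volume.restrict {0}ᶜ) :=
      hco.continuousOn.aestronglyMeasurable (measurableSet_singleton _).compl
    have h2 : (volume.restrict ({0}ᶜ : Set (Euc (n+1)))) = volume := by
      rw [Measure.restrict_eq_self_of_ae_mem]; exact hne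
    rwa [h2] at h1
  have hui : LocallyIntegrable u volume := by
    refine locallyIntegrable_of_norm_le_rpow (C := 1) (α := 0) (by simp) (by simp; positivity)
        (ae_of_all _ fun x => ?_) hum
    simpa using hb x
  have hgi : LocallyIntegrable (fun x => fderiv ℝ u x) volume := by
    refine locallyIntegrable_of_norm_le_rpow (C := 15) (α := 1) (by simp) (by simp; omega)
        ?_ (measurable_fderiv ℝ u).aestronglyMeasurable
    filter_upwards [hne] with x hx
    rw [Real.rpow_neg_one]
    have hxp := norm_pos_iff.2 hx
    have h := hgr x hx
    split_ifs at h with hc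
    · have hns := norm_le_split x
      have hlp : 0 < |lastC x| := by linarith [hc.2]
      have : |lastC x|⁻¹ ≤ 5 * ‖x‖⁻¹ := by
        rw [← div_eq_mul_inv, le_div_iff₀ hxp, inv_mul_le_iff₀ hlp]; linarith [hc.2]
      linarith
    · have : 0 < ‖x‖⁻¹ := by positivity
      linarith
  refine ⟨⟨1, hb⟩, hui, hgi, ?_, hco, 3, by norm_num, hgr⟩
  intro φ hφ hφc _
  rw [setIntegral_univ, setIntegral_univ]
  have hφ1 : ContDiff ℝ 1 φ := hφ.of_le (by exact_mod_cast le_top)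
  have i1 : Integrable (fun x => u x • fderiv ℝ φ x) :=
    hui.integrable_smul_right_of_hasCompactSupport (hφ1.continuous_fderiv one_ne_zero)
      (hφc.fderiv ℝ)
  have i2 : Integrable (fun x => φ x • fderiv ℝ u x) :=
    hgi.integrable_smul_left_of_hasCompactSupport hφ1.continuous hφc
  have hae : (fun x => fderiv ℝ (fun y => u y * φ y) x) =ᵐ[volume]
      fun x => u x • fderiv ℝ φ x + φ x • fderiv ℝ u x := by
    filter_upwards [hne] with x hx
    exact fderiv_mul ((hsm x hx).differentiableAt (by simp))
      (hφ1.differentiable one_ne_zero x)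
  have i3 : Integrable (fun x => fderiv ℝ (fun y => u y * φ y) x) := by
    refine Integrable.congr ?_ hae.symm
    exact Integrable.add (ε' := Euc (n+1) →L[ℝ] ℝ) i1 i2
  obtain ⟨M, hM⟩ := hφc.exists_bound_of_continuous hφ1.continuous
  have hz := aux_integral_fderiv_zero hn (fun y => u y * φ y)
    ((hco.of_le (by exact_mod_cast le_top)).mul hφ1.contDiffOn) hφc.mul_left M
    (fun x => by
      rw [abs_mul]
      exact (mul_le_of_le_one_left (abs_nonneg _) (hb x)).trans (hM x))
    i3
  rw [integral_congr_ae hae, integral_add i1 i2] at hz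
  exact eq_neg_of_add_eq_zero_left hz
end
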